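/- Let X be a nonempty compact metric space, α : X → X a minimal homeomorphism, and Y ⊆ X a closed subset with non-empty interior. Let r ≥ 1, let z₁, z₂ ∈ closure(Y_r) where Y_r = {y ∈ Y : r_Y(y) = r}, and let integers i, j satisfy 0 ≤ i < j < r. If α^i(z₁) = α^j(z₂), then z₁ ∉ Y_r and z₂ ∉ Y_r; that is, both z₁ and z₂ lie in closure(Y_r) \ Y_r. -/

import Mathlib

open Set

/-- A homeomorphism of a topological space is *minimal* if every (two-sided) orbit
`{α^n x : n ∈ ℤ}` is dense. -/
def IsMinimalHomeo {X : Type*} [TopologicalSpace X] (α : X ≃ₜ X) : Prop :=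
  ∀ x : X, Dense (Set.range fun n : ℤ => (α.toEquiv ^ n) x)

/-- The first return time of `x` to `Y` under `α`: the least `n ≥ 1` with `α^n x ∈ Y`
(the `sInf` of the empty set being `0` when no such `n` exists). -/
noncomputable def firstReturn {X : Type*} [TopologicalSpace X] (α : X ≃ₜ X) (Y : Set X)
    (x : X) : ℕ :=
  sInf {n : ℕ | 1 ≤ n ∧ (α.toEquiv ^ n) x ∈ Y}

/-- `returnSet α Y r = Y_r = {y ∈ Y | r_Y(y) = r}`. -/
def returnSet {X : Type*} [TopologicalSpace X] (α : X ≃ₜ X) (Y : Set X) (r : ℕ) : Set X :=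
  {y : X | y ∈ Y ∧ firstReturn α Y y = r}

theorem continuous_toEquiv_pow {X : Type*} [TopologicalSpace X] (α : X ≃ₜ X) (n : ℕ) :
    Continuous fun x => (α.toEquiv ^ n) x := by
  induction n with
  | zero => exact continuous_id
  | succ n ih =>
    simp only [pow_succ, Equiv.Perm.mul_apply]
    exact ih.comp α.continuous

theorem closure_returnSet_subset {X : Type*} [TopologicalSpace X] (α : X ≃ₜ X) {Y : Set X}
    (hY : IsClosed Y) (r : ℕ) : closure (returnSet α Y r) ⊆ Y :=
  closure_minimal (fun _ hy => hy.1) hY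

theorem pow_mem_of_mem_closure_returnSet {X : Type*} [TopologicalSpace X] (α : X ≃ₜ X)
    {Y : Set X} (hY : IsClosed Y) {r : ℕ} (hr : 1 ≤ r) {z : X}
    (hz : z ∈ closure (returnSet α Y r)) : (α.toEquiv ^ r) z ∈ Y := by
  refine closure_minimal ?_ (hY.preimage (continuous_toEquiv_pow α r)) hz
  rintro y ⟨-, hy⟩
  have hmem := Nat.sInf_mem (Nat.nonempty_of_sInf_eq_succ (k := r - 1)
    (hy.trans (Nat.sub_add_cancel hr).symm))
  have hpow := hmem.2
  change (α.toEquiv ^ firstReturn α Y y) y ∈ Y at hpow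
  rwa [hy] at hpow

theorem notMem_returnSet_of_pow_mem {X : Type*} [TopologicalSpace X] (α : X ≃ₜ X)
    {Y : Set X} {r n : ℕ} (hn : 1 ≤ n) (hnr : n < r) {z : X} (hz : (α.toEquiv ^ n) z ∈ Y) :
    z ∉ returnSet α Y r := fun h =>
  hnr.not_ge (h.2 ▸ Nat.sInf_le ⟨hn, hz⟩)

/-- if `z₁, z₂ ∈ closure(Y_r)`, `0 ≤ i < j < r` and `α^i z₁ = α^j z₂`, then
both `z₁` and `z₂` lie in `closure(Y_r) \ Y_r`. -/
theorem overlap_forces_boundary {X : Type*} [MetricSpace X] [CompactSpace X]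
    [Nonempty X] (α : X ≃ₜ X) (hmin : IsMinimalHomeo α) (Y : Set X)
    (hYclosed : IsClosed Y) (hYint : (interior Y).Nonempty)
    (r : ℕ) (hr : 1 ≤ r) (z₁ z₂ : X)
    (hz₁ : z₁ ∈ closure (returnSet α Y r)) (hz₂ : z₂ ∈ closure (returnSet α Y r))
    (i j : ℕ) (hij : i < j) (hj : j < r)
    (heq : (α.toEquiv ^ i) z₁ = (α.toEquiv ^ j) z₂) :
    z₁ ∉ returnSet α Y r ∧ z₂ ∉ returnSet α Y r := by
  obtain ⟨k, rfl⟩ := Nat.exists_eq_add_of_lt hij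
  have hz : z₁ = (α.toEquiv ^ (k + 1)) z₂ := by
    rw [add_assoc, pow_add, Equiv.Perm.mul_apply] at heq
    exact (α.toEquiv ^ i).injective heq
  constructor
  · refine notMem_returnSet_of_pow_mem α (n := r - (k + 1)) (by omega) (by omega) ?_
    rw [hz, ← Equiv.Perm.mul_apply, ← pow_add, Nat.sub_add_cancel (by omega)]
    exact pow_mem_of_mem_closure_returnSet α hYclosed hr hz₂
  · refine notMem_returnSet_of_pow_mem α (n := k + 1) (by omega) (by omega) ?_
    rw [← hz]
    exact closure_returnSet_subset α hYclosed r hz₁
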